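/- For all real numbers a, b and every natural number n ≥ 1, Ψ(a, b, n) = Σ_{i=0}^{⌊n/2⌋} (n/(n-i)) · C(n-i, i) · (-a)^i · (2a - b)^{⌊n/2⌋ - i}, where C(·,·) denotes the binomial coefficient. -/

import Mathlib

/-- The `Ψ` sequence over the reals: `Ψ a b 0 = 2`, `Ψ a b 1 = 1`, and
`Ψ a b (m+2) = (2a-b)^(δ(m+1)) * Ψ a b (m+1) - a * Ψ a b m`. -/
def psiR (a b : ℝ) : ℕ → ℝ
  | 0 => 2
  | 1 => 1
  | m + 2 => (2 * a - b) ^ ((m + 1) % 2) * psiR a b (m + 1) - a * psiR a b m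

/-- The recurrence `c (n + 2) (i + 1) = c (n + 1) (i + 1) + c n i` of the Lucas coefficients
`c n i = n / (n - i) * (n - i).choose i`, written with `n = m + i`. -/
theorem lucas_coeff_recurrence (m i : ℕ) (hm : m ≠ 0) :
    ((m : ℝ) + i + 2) / (m + 1) * ((m + 1).choose (i + 1) : ℝ) =
      ((m : ℝ) + i + 1) / m * (m.choose (i + 1) : ℝ) + ((m : ℝ) + i) / m * (m.choose i : ℝ) := by
  have hm' : (m : ℝ) ≠ 0 := Nat.cast_ne_zero.mpr hm
  have hm1 : (m : ℝ) + 1 ≠ 0 := Nat.cast_add_one_ne_zero m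
  have absorb : (m.choose (i + 1) : ℝ) * (i + 1) = m.choose i * (m - i) := by
    rcases le_or_gt i m with h | h
    · have := Nat.choose_succ_right_eq m i
      rw [← Nat.cast_sub h]
      exact_mod_cast this
    · simp [Nat.choose_eq_zero_of_lt h, Nat.choose_eq_zero_of_lt (Nat.lt_succ_of_lt h)]
  rw [Nat.choose_succ_succ]
  push_cast
  field_simp
  linear_combination -absorb

/-- The `i`-th summand of the explicit formula, with `t` in place of `2a - b`. -/
noncomputable def psiTerm (a t : ℝ) (n i : ℕ) : ℝ :=
  ((n : ℝ) / ((n : ℝ) - (i : ℝ))) * ((n - i).choose i : ℝ) * (-a) ^ i * t ^ (n / 2 - i)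

theorem psiTerm_eq_zero (a t : ℝ) {n i : ℕ} (h : n / 2 < i) : psiTerm a t n i = 0 := by
  simp [psiTerm, Nat.choose_eq_zero_of_lt (show n - i < i by omega)]

theorem psiTerm_zero (a t : ℝ) {n : ℕ} (hn : n ≠ 0) : psiTerm a t n 0 = t ^ (n / 2) := by
  simp [psiTerm, hn]

theorem psiTerm_recurrence (a t : ℝ) {n i : ℕ} (hn : n ≠ 0) (hi : i ≤ n / 2) :
    psiTerm a t (n + 2) (i + 1) =
      t ^ ((n + 1) % 2) * psiTerm a t (n + 1) (i + 1) - a * psiTerm a t n i := by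
  obtain ⟨m, rfl⟩ : ∃ m, n = m + i := ⟨n - i, by omega⟩
  have hpow : t ^ ((m + i + 1) % 2) * psiTerm a t (m + i + 1) (i + 1) =
      ((m : ℝ) + i + 1) / m * (m.choose (i + 1) : ℝ) * (-a) ^ (i + 1) * t ^ ((m + i) / 2 - i) := by
    rcases lt_or_ge ((m + i + 1) / 2) (i + 1) with h | h
    · rw [psiTerm_eq_zero a t h, Nat.choose_eq_zero_of_lt (show m < i + 1 by omega)]
      simp
    · rw [show (m + i) / 2 - i = (m + i + 1) % 2 + ((m + i + 1) / 2 - (i + 1)) by omega, pow_add,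
        psiTerm, show m + i + 1 - (i + 1) = m by omega]
      push_cast
      rw [show (m : ℝ) + i + 1 - (i + 1) = m by ring]
      ring
  rw [hpow, psiTerm, psiTerm, show m + i + 2 - (i + 1) = m + 1 by omega,
    show (m + i + 2) / 2 - (i + 1) = (m + i) / 2 - i by omega, Nat.add_sub_cancel]
  push_cast
  rw [show (m : ℝ) + i + 2 - (i + 1) = m + 1 by ring, add_sub_cancel_right,
    lucas_coeff_recurrence m i (by omega)]
  ring

theorem sum_psiTerm_recurrence (a t : ℝ) {n : ℕ} (hn : n ≠ 0) :
    ∑ i ∈ Finset.range ((n + 2) / 2 + 1), psiTerm a t (n + 2) i =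
      t ^ ((n + 1) % 2) * ∑ i ∈ Finset.range ((n + 1) / 2 + 1), psiTerm a t (n + 1) i -
        a * ∑ i ∈ Finset.range (n / 2 + 1), psiTerm a t n i := by
  have hext : ∑ i ∈ Finset.range ((n + 1) / 2 + 1), psiTerm a t (n + 1) i =
      ∑ i ∈ Finset.range (n / 2 + 1 + 1), psiTerm a t (n + 1) i := by
    refine Finset.sum_subset (Finset.range_mono (by omega)) fun i _ hi => ?_
    exact psiTerm_eq_zero a t (by rw [Finset.mem_range] at hi; omega)
  rw [hext, show (n + 2) / 2 + 1 = n / 2 + 1 + 1 by omega, Finset.sum_range_succ',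
    Finset.sum_range_succ' (psiTerm a t (n + 1)), psiTerm_zero a t (by omega),
    psiTerm_zero a t (by omega),
    Finset.sum_congr rfl fun i hi =>
      psiTerm_recurrence a t hn (Nat.lt_succ_iff.mp (Finset.mem_range.mp hi)),
    Finset.sum_sub_distrib, ← Finset.mul_sum, ← Finset.mul_sum,
    show (n + 2) / 2 = (n + 1) % 2 + (n + 1) / 2 by omega, pow_add]
  ring

theorem psiR_eq_sum_psiTerm (a b : ℝ) (n : ℕ) :
    psiR a b (n + 1) =
      ∑ i ∈ Finset.range ((n + 1) / 2 + 1), psiTerm a (2 * a - b) (n + 1) i := by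
  induction n using Nat.twoStepInduction with
  | zero => simp [psiR, psiTerm]
  | one =>
    simp [psiR, psiTerm, Finset.sum_range_succ]
    ring
  | more n ih₀ ih₁ =>
    rw [sum_psiTerm_recurrence a _ n.succ_ne_zero, ← ih₀, ← ih₁, psiR]

theorem psi_explicit_formula
    (a b : ℝ) (n : ℕ) (hn : 1 ≤ n) :
    psiR a b n =
      ∑ i ∈ Finset.range (n / 2 + 1),
        ((n : ℝ) / ((n : ℝ) - (i : ℝ))) * ((n - i).choose i : ℝ) *
          (-a) ^ i * (2 * a - b) ^ (n / 2 - i) := by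
  obtain ⟨m, rfl⟩ := Nat.exists_eq_add_of_le' hn
  exact psiR_eq_sum_psiTerm a b m
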